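/- arXiv:2406.16172 — 3 statements merged into one kernel-verified Lean document; each statement's English description precedes it below -/
import Mathlib

section
/- Let d ≥ 3 be an odd integer and let n ≥ 0. Suppose u₀, u₁, …, u_n ∈ ℂ satisfy u₀² = −d, and for each 0 ≤ k < n there exists α ∈ ℂ with α^{d−1} + α^{d−2} + ⋯ + α + 1 + d·u_k² = 0 and u_k·u_{k+1} = α^{(d−1)/2}. Then u_n² ≠ −1/d. -/
/-- A geometric sum of `d` terms has norm at most `d` when the ratio lies in the unit disc. -/
theorem norm_geom_sum_le_of_norm_le_one {α : ℂ} (hα : ‖α‖ ≤ 1) (d : ℕ) :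
    ‖∑ j ∈ Finset.range d, α ^ j‖ ≤ d := by
  calc ‖∑ j ∈ Finset.range d, α ^ j‖ ≤ ∑ _j ∈ Finset.range d, (1 : ℝ) :=
        norm_sum_le_of_le _ fun j _ => by
          rw [norm_pow]; exact pow_le_one₀ (norm_nonneg _) hα
    _ = d := by simp

/-- Outside the closed unit disc, a geometric sum is dominated by its top term. -/
theorem norm_geom_sum_lt_of_one_lt_norm {α : ℂ} (hα : 1 < ‖α‖) {d : ℕ} (hd : 2 ≤ d) :
    ‖∑ j ∈ Finset.range d, α ^ j‖ < d * ‖α‖ ^ (d - 1) := by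
  calc ‖∑ j ∈ Finset.range d, α ^ j‖ ≤ ∑ j ∈ Finset.range d, ‖α‖ ^ j :=
        norm_sum_le_of_le _ fun j _ => (norm_pow α j).le
    _ < ∑ _j ∈ Finset.range d, ‖α‖ ^ (d - 1) := by
        refine Finset.sum_lt_sum (fun j hj => ?_) ⟨0, Finset.mem_range.2 (by omega), ?_⟩
        · have := Finset.mem_range.1 hj
          exact pow_le_pow_right₀ hα.le (by omega)
        · exact pow_lt_pow_right₀ hα (by omega)
    _ = d * ‖α‖ ^ (d - 1) := by simp

/-- The exterior of the closed unit disc is forward invariant under the billiard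
correspondence. -/
theorem one_lt_norm_of_billiard_step {d : ℕ} (hd : 2 ≤ d) (hodd : Odd d) {u v α : ℂ}
    (hu : 1 < ‖u‖) (hsum : ∑ j ∈ Finset.range d, α ^ j + d * u ^ 2 = 0)
    (huv : u * v = α ^ ((d - 1) / 2)) : 1 < ‖v‖ := by
  have hd0 : (0 : ℝ) < d := by exact_mod_cast (by omega : 0 < d)
  have hnorm : ‖∑ j ∈ Finset.range d, α ^ j‖ = d * ‖u‖ ^ 2 := by
    rw [eq_neg_of_add_eq_zero_left hsum]; simp
  have hu2 : 1 < ‖u‖ ^ 2 := one_lt_pow₀ hu two_ne_zero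
  have hα : 1 < ‖α‖ := by
    by_contra! h
    have := norm_geom_sum_le_of_norm_le_one h d
    nlinarith
  have hlt := norm_geom_sum_lt_of_one_lt_norm hα hd
  have hprod : ‖α‖ ^ (d - 1) = ‖u‖ ^ 2 * ‖v‖ ^ 2 := by
    have hexp : d - 1 = (d - 1) / 2 * 2 := by
      obtain ⟨k, rfl⟩ := hodd; omega
    rw [hexp, pow_mul, ← norm_pow, ← huv, norm_mul, mul_pow]
  rw [hnorm, hprod] at hlt
  have h1 : ‖u‖ ^ 2 < ‖u‖ ^ 2 * ‖v‖ ^ 2 := lt_of_mul_lt_mul_left hlt hd0.le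
  have h2 : 1 < ‖v‖ ^ 2 := (lt_mul_iff_one_lt_right (by positivity)).1 h1
  exact (one_lt_pow_iff_of_nonneg (norm_nonneg v) two_ne_zero).1 h2

/-- Algebraic stability of the model `P` for odd degree: on the midpoint divisor, no forward
orbit of the billiard correspondence starting in the exceptional set `{u : u² = -d}` ever
reaches the indeterminacy set `{u : u² = -1/d}`. -/
theorem fermat_billiard_orbit_avoids_indeterminacy_odd (d : ℕ) (hd : 3 ≤ d) (hodd : Odd d)
    (n : ℕ) (u : ℕ → ℂ) (h0 : u 0 ^ 2 = -(d : ℂ))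
    (hstep : ∀ m : ℕ, m < n → ∃ α : ℂ,
      ∑ j ∈ Finset.range d, α ^ j + d * u m ^ 2 = 0 ∧
      u m * u (m + 1) = α ^ ((d - 1) / 2)) :
    u n ^ 2 ≠ -1 / d := by
  have hd1 : (1 : ℝ) < d := by exact_mod_cast (by omega : 1 < d)
  have key : ∀ m ≤ n, 1 < ‖u m‖ := by
    intro m
    induction m with
    | zero =>
      intro _
      refine (one_lt_pow_iff_of_nonneg (norm_nonneg _) two_ne_zero).1 ?_
      rw [← norm_pow, h0]
      simpa using hd1
    | succ m ih =>
      intro hm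
      obtain ⟨α, hsum, hmul⟩ := hstep m hm
      exact one_lt_norm_of_billiard_step (by omega) hodd (ih (by omega)) hsum hmul
  intro h
  have h2 : 1 < ‖u n‖ ^ 2 := one_lt_pow₀ (key n le_rfl) two_ne_zero
  rw [← norm_pow, h, norm_div, norm_neg, norm_one, Complex.norm_natCast,
    one_lt_div (by linarith)] at h2
  linarith
end

section
/- Let d ≥ 2 be an even integer and let n ≥ 0. Suppose u₀, u₁, …, u_n ∈ ℂ satisfy u₀ = −d, and for each 0 ≤ k < n there exists α ∈ ℂ with α^{d−1} + α^{d−2} + ⋯ + α + 1 + d·u_k = 0 and u_k·u_{k+1} = α^{d−1}. Then u_n ≠ −1/d. -/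
/-- If the geometric sum of `α` of length `d` has norm at least `d`, the norm of the sum is at
most `d * ‖α‖ ^ (d - 1)`. -/
theorem norm_geom_sum_le_of_le {d : ℕ} (hd : 2 ≤ d) {α : ℂ}
    (h : (d : ℝ) ≤ ‖∑ j ∈ Finset.range d, α ^ j‖) :
    ‖∑ j ∈ Finset.range d, α ^ j‖ ≤ d * ‖α‖ ^ (d - 1) := by
  have hsum : ‖∑ j ∈ Finset.range d, α ^ j‖ ≤ ∑ j ∈ Finset.range d, ‖α‖ ^ j := by
    simpa only [norm_pow] using norm_sum_le (Finset.range d) fun j => α ^ j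
  have hα : 1 ≤ ‖α‖ := by
    by_contra! hlt
    have : ∑ j ∈ Finset.range d, ‖α‖ ^ j < ∑ _j ∈ Finset.range d, (1 : ℝ) :=
      Finset.sum_lt_sum (fun j _ => pow_le_one₀ (norm_nonneg α) hlt.le)
        ⟨1, Finset.mem_range.2 hd, by simpa using hlt⟩
    simp only [Finset.sum_const, Finset.card_range, nsmul_eq_mul, mul_one] at this
    linarith
  calc ‖∑ j ∈ Finset.range d, α ^ j‖ ≤ ∑ j ∈ Finset.range d, ‖α‖ ^ j := hsum
    _ ≤ ∑ _j ∈ Finset.range d, ‖α‖ ^ (d - 1) :=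
      Finset.sum_le_sum fun j hj =>
        pow_le_pow_right₀ hα (Nat.le_sub_one_of_lt (Finset.mem_range.1 hj))
    _ = d * ‖α‖ ^ (d - 1) := by simp

/-- The complement of the open unit disc is forward invariant under the billiard
correspondence. -/
theorem one_le_norm_of_billiard_step {d : ℕ} (hd : 2 ≤ d) {u v α : ℂ} (hu : 1 ≤ ‖u‖)
    (hα : ∑ j ∈ Finset.range d, α ^ j + d * u = 0) (huv : u * v = α ^ (d - 1)) :
    1 ≤ ‖v‖ := by
  have hd0 : (0 : ℝ) < d := by positivity
  have hnorm : ‖∑ j ∈ Finset.range d, α ^ j‖ = d * ‖u‖ := by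
    rw [eq_neg_of_add_eq_zero_left hα, norm_neg, norm_mul, Complex.norm_natCast]
  have hle := norm_geom_sum_le_of_le hd (α := α) (by rw [hnorm]; nlinarith)
  rw [hnorm, ← norm_pow, ← huv, norm_mul] at hle
  have : ‖u‖ ≤ ‖u‖ * ‖v‖ := le_of_mul_le_mul_left hle hd0
  exact (le_mul_iff_one_le_right (by linarith)).1 this


/-- Algebraic stability of the model `P₊` for even degree: on the midpoint divisor, no
forward orbit of the billiard correspondence starting at the exceptional point `-d` ever
reaches the indeterminacy point `-1/d`. -/
theorem fermat_billiard_orbit_avoids_indeterminacy_even (d : ℕ) (hd : 2 ≤ d) (heven : Even d)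
    (n : ℕ) (u : ℕ → ℂ) (h0 : u 0 = -(d : ℂ))
    (hstep : ∀ m : ℕ, m < n → ∃ α : ℂ,
      ∑ j ∈ Finset.range d, α ^ j + d * u m = 0 ∧
      u m * u (m + 1) = α ^ (d - 1)) :
    u n ≠ -1 / d := by
  have hd' : (2 : ℝ) ≤ d := by exact_mod_cast hd
  have hnorm : ∀ m ≤ n, 1 ≤ ‖u m‖ := by
    intro m
    induction m with
    | zero =>
      intro _
      rw [h0, norm_neg, Complex.norm_natCast]
      linarith
    | succ m ih =>
      intro hm
      obtain ⟨α, hα, huv⟩ := hstep m hm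
      exact one_le_norm_of_billiard_step hd (ih (Nat.le_of_succ_le hm)) hα huv
  intro h
  have hn := hnorm n le_rfl
  rw [h, norm_div, norm_neg, norm_one, Complex.norm_natCast, le_div_iff₀ (by linarith)] at hn
  linarith
end

section
/- Let d ≥ 2 be an integer and let k be an algebraically closed field with char k = 0 or gcd(char k, 2d) = 1, and fix i ∈ k with i² = −1. Consider the set S of pairs ([x:y], (q₀,q₁)) where [x:y] is a point of the projective line over k with (x−iy)^d + (x+iy)^d = 0, and (q₀,q₁) ∈ k² satisfies q₀² + q₁² = 1 and x·q₁ = y·q₀. Then S has exactly 2d elements. -/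
/-- In an algebraically closed field, a nonzero element has exactly `n` distinct `n`-th roots
when `n` is invertible. -/
lemma ncard_pow_eq_of_ne_zero {k : Type*} [Field k] [IsAlgClosed k] {n : ℕ} (hn : (n : k) ≠ 0)
    {a : k} (ha : a ≠ 0) : {u : k | u ^ n = a}.ncard = n := by
  have hn0 : 0 < n := Nat.pos_of_ne_zero (by rintro rfl; simp at hn)
  have hsep := Polynomial.separable_X_pow_sub_C a hn ha
  have hroots : {u : k | u ^ n = a} = (Polynomial.X ^ n - Polynomial.C a).rootSet k := by
    ext u
    simp [Polynomial.mem_rootSet, Polynomial.X_pow_sub_C_ne_zero hn0, sub_eq_zero]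
  rw [hroots, ← Nat.card_coe_set_eq, Nat.card_eq_fintype_card,
    Polynomial.card_rootSet_eq_natDegree hsep (IsAlgClosed.splits _),
    Polynomial.natDegree_X_pow_sub_C]

/-- A point of the projective line whose slope is that of the unit vector `(a, b)` is
represented by a nonzero multiple of `(a, b)`. -/
lemma Projectivization.exists_rep_eq_mul_of_unit {k : Type*} [Field k]
    (p : Projectivization k (Fin 2 → k)) {a b : k} (hab : a ^ 2 + b ^ 2 = 1)
    (h : p.rep 0 * b = p.rep 1 * a) :
    ∃ c : k, c ≠ 0 ∧ p.rep 0 = c * a ∧ p.rep 1 = c * b := by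
  have h0 : p.rep 0 = (p.rep 0 * a + p.rep 1 * b) * a := by
    linear_combination -p.rep 0 * hab + b * h
  have h1 : p.rep 1 = (p.rep 0 * a + p.rep 1 * b) * b := by
    linear_combination -p.rep 1 * hab - a * h
  refine ⟨p.rep 0 * a + p.rep 1 * b, fun hc => p.rep_nonzero ?_, h0, h1⟩
  rw [hc, zero_mul] at h0 h1
  ext j
  fin_cases j
  · exact h0
  · exact h1

/-- If `v * u = 1`, then `v ^ d + u ^ d` vanishes exactly when `u ^ (2 * d) = -1`. -/
lemma pow_add_pow_eq_zero_iff_of_mul_eq_one {k : Type*} [Field k] {u v : k} (h : v * u = 1)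
    (d : ℕ) : v ^ d + u ^ d = 0 ↔ u ^ (2 * d) = -1 := by
  have hp : v ^ d * u ^ d = 1 := by rw [← mul_pow, h, one_pow]
  rw [two_mul, pow_add]
  constructor
  · intro h0
    linear_combination u ^ d * h0 - hp
  · intro h1
    linear_combination v ^ d * h1 - u ^ d * hp

/-- The indeterminacy locus of the secant correspondence of the Fermat hyperbola billiard
consists of exactly `2d` points: pairs of a point `[x:y]` at infinity of the Fermat
hyperbola (i.e. `(x-iy)^d + (x+iy)^d = 0`) together with a unit tangent vector `(q₀,q₁)`
of that slope (i.e. `q₀² + q₁² = 1` and `x q₁ = y q₀`). -/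
theorem fermat_secant_indeterminacy_card (d : ℕ) (hd : 2 ≤ d)
    (k : Type*) [Field k] [IsAlgClosed k]
    (hchar : ringChar k = 0 ∨ Nat.gcd (ringChar k) (2 * d) = 1)
    (i : k) (hi : i ^ 2 = -1)
    (S : Set (Projectivization k (Fin 2 → k) × (k × k)))
    (hS : S = {s : Projectivization k (Fin 2 → k) × (k × k) |
      (s.1.rep 0 - i * s.1.rep 1) ^ d + (s.1.rep 0 + i * s.1.rep 1) ^ d = 0 ∧
      s.2.1 ^ 2 + s.2.2 ^ 2 = 1 ∧
      s.1.rep 0 * s.2.2 = s.1.rep 1 * s.2.1}) :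
    S.ncard = 2 * d := by
  have hn : ((2 * d : ℕ) : k) ≠ 0 := by
    intro h
    have hdvd := (ringChar.spec k (2 * d)).1 h
    rcases hchar with h0 | h1
    · rw [h0, zero_dvd_iff] at hdvd
      omega
    · rw [Nat.gcd_eq_left hdvd] at h1
      exact CharP.ringChar_ne_one h1
  have h2 : (2 : k) ≠ 0 := by
    intro h
    apply hn
    push_cast
    rw [h, zero_mul]
  have hi0 : i ≠ 0 := by
    rintro rfl
    simp at hi
  have hunit : ∀ a b : k, a ^ 2 + b ^ 2 = 1 → (a - i * b) * (a + i * b) = 1 := by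
    intro a b h
    linear_combination h - b ^ 2 * hi
  have hmem : ∀ (p : Projectivization k (Fin 2 → k)) (a b c : k), a ^ 2 + b ^ 2 = 1 → c ≠ 0 →
      p.rep 0 = c * a → p.rep 1 = c * b →
      ((p.rep 0 - i * p.rep 1) ^ d + (p.rep 0 + i * p.rep 1) ^ d = 0 ↔
        (a + i * b) ^ (2 * d) = -1) := by
    intro p a b c hab hc h0 h1
    rw [← pow_add_pow_eq_zero_iff_of_mul_eq_one (hunit a b hab) d, h0, h1,
      show c * a - i * (c * b) = c * (a - i * b) by ring,
      show c * a + i * (c * b) = c * (a + i * b) by ring, mul_pow, mul_pow, ← mul_add,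
      mul_eq_zero, or_iff_right (pow_ne_zero d hc)]
  have himage : (fun s : Projectivization k (Fin 2 → k) × (k × k) => s.2.1 + i * s.2.2) '' S =
      {u : k | u ^ (2 * d) = -1} := by
    subst hS
    ext u
    constructor
    · rintro ⟨⟨p, a, b⟩, ⟨hp, hab, hslope⟩, rfl⟩
      obtain ⟨c, hc, h0, h1⟩ := p.exists_rep_eq_mul_of_unit hab hslope
      exact (hmem p a b c hab hc h0 h1).1 hp
    · intro hu
      have hu0 : u ≠ 0 := by
        rintro rfl
        simp [show d ≠ 0 by omega] at hu
      obtain ⟨a, ha⟩ : ∃ a, a = (u + u⁻¹) / 2 := ⟨_, rfl⟩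
      obtain ⟨b, hb⟩ : ∃ b, b = (u - u⁻¹) / (2 * i) := ⟨_, rfl⟩
      have hsum : a + i * b = u := by
        rw [ha, hb]
        field_simp
        ring
      have hdiff : a - i * b = u⁻¹ := by
        rw [ha, hb]
        field_simp
        ring
      have hab : a ^ 2 + b ^ 2 = 1 := by
        have h : (a - i * b) * (a + i * b) = 1 := by rw [hsum, hdiff, inv_mul_cancel₀ hu0]
        linear_combination h + b ^ 2 * hi
      have hv : (![a, b] : Fin 2 → k) ≠ 0 := by
        intro h
        have h0 : a = 0 := congrFun h 0
        have h1 : b = 0 := congrFun h 1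
        simp [h0, h1] at hab
      obtain ⟨c, hc⟩ := Projectivization.exists_smul_eq_mk_rep k _ hv
      have h0 : (Projectivization.mk k _ hv).rep 0 = c * a := (congrFun hc 0).symm
      have h1 : (Projectivization.mk k _ hv).rep 1 = c * b := (congrFun hc 1).symm
      refine ⟨(Projectivization.mk k _ hv, a, b), ⟨?_, hab, ?_⟩, hsum⟩
      · rw [hmem _ a b c hab c.ne_zero h0 h1, hsum]
        exact hu
      · simp only [h0, h1]
        ring
  have hinj : Set.InjOn
      (fun s : Projectivization k (Fin 2 → k) × (k × k) => s.2.1 + i * s.2.2) S := by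
    subst hS
    rintro ⟨p, a, b⟩ ⟨-, hab, hp⟩ ⟨p', a', b'⟩ ⟨-, hab', hp'⟩ heq
    dsimp only at hab hp hab' hp' heq
    have hdiff : a - i * b = a' - i * b' := by
      rw [eq_inv_of_mul_eq_one_left (hunit a b hab), heq,
        ← eq_inv_of_mul_eq_one_left (hunit a' b' hab')]
    obtain rfl : a = a' := mul_left_cancel₀ h2 (by linear_combination heq + hdiff)
    obtain rfl : b = b' := mul_left_cancel₀ hi0 (by linear_combination heq)
    obtain ⟨c, hc, h0, h1⟩ := p.exists_rep_eq_mul_of_unit hab hp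
    obtain ⟨c', hc', h0', h1'⟩ := p'.exists_rep_eq_mul_of_unit hab hp'
    have hpp' : p = p' := by
      rw [← p.mk_rep, ← p'.mk_rep, Projectivization.mk_eq_mk_iff']
      refine ⟨c / c', ?_⟩
      ext j
      fin_cases j
      · simp [h0, h0', ← mul_assoc, hc']
      · simp [h1, h1', ← mul_assoc, hc']
    rw [hpp']
  rw [← hinj.ncard_image, himage,
    ncard_pow_eq_of_ne_zero hn (neg_ne_zero.2 one_ne_zero)]
end
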